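/- Let 𝒜 be of nonstandard p(·)-growth with constants a₋, b⁺ and assume p⁻ > n. Let f : ℝ → ℝ be a continuous nonnegative strictly increasing function with f(0) ≠ 0. Then there exists no bounded supersolution of div 𝒜(x,u,∇u) = f(u) in ℝⁿ. -/

import Mathlib

open MeasureTheory Metric Real
open scoped ContDiff

noncomputable section

abbrev Euc (n : ℕ) := EuclideanSpace ℝ (Fin n)

/-- Measure of the unit ball in `ℝⁿ`. -/
def omegaEuc (n : ℕ) : ℝ := (volume (Metric.ball (0 : Euc n) 1)).toReal

/-- A measurable variable exponent `p` with `p⁻ = pm` and `p⁺ = pP`,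
`1 < p⁻` and `p⁺ < ∞` (encoded by the a.e. bounds). -/
structure IsVarExp {n : ℕ} (p : Euc n → ℝ) (pm pP : ℝ) : Prop where
  meas : Measurable p
  one_lt : 1 < pm
  inf_eq : essInf p (volume : Measure (Euc n)) = pm
  sup_eq : essSup p (volume : Measure (Euc n)) = pP
  ae_lb : ∀ᵐ x ∂(volume : Measure (Euc n)), pm ≤ p x
  ae_ub : ∀ᵐ x ∂(volume : Measure (Euc n)), p x ≤ pP

/-- `𝒜` is of nonstandard `p(·)`-growth with constants `am = a₋`, `bP = b⁺`. -/
structure IsNSGrowth {n : ℕ} (p : Euc n → ℝ) (𝒜 : Euc n → ℝ → Euc n → Euc n)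
    (am bP : ℝ) : Prop where
  am_pos : 0 < am
  meas : ∀ (t : ℝ) (ξ : Euc n), Measurable (fun x => 𝒜 x t ξ)
  cont : ∀ x : Euc n, Continuous (fun tξ : ℝ × Euc n => 𝒜 x tξ.1 tξ.2)
  growth : ∃ a b : Euc n → ℝ, Measurable a ∧ Measurable b ∧
      (∀ x, am ≤ a x ∧ a x ≤ b x ∧ b x ≤ bP) ∧
      (∀ x t ξ, a x * ‖ξ‖ ^ p x ≤ (inner ℝ (𝒜 x t ξ) ξ : ℝ)) ∧
      (∀ x t ξ, ‖𝒜 x t ξ‖ ≤ b x * ‖ξ‖ ^ (p x - 1))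

/-- `u` is `𝒜`-harmonic in `ℝⁿ` (C¹ functions replace `W^{1,p(·)}_loc`). -/
def IsAHarmonic {n : ℕ} (p : Euc n → ℝ) (𝒜 : Euc n → ℝ → Euc n → Euc n)
    (u : Euc n → ℝ) : Prop :=
  ContDiff ℝ 1 u ∧
  LocallyIntegrable (fun x => ‖gradient u x‖ ^ p x) (volume : Measure (Euc n)) ∧
  ∀ φ : Euc n → ℝ, ContDiff ℝ ∞ φ → HasCompactSupport φ →
    ∫ x, (inner ℝ (𝒜 x (u x) (gradient u x)) (gradient φ x) : ℝ) = 0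

/-- `u` is an `𝒜`-subsolution in `ℝⁿ`. -/
def IsASubsolution {n : ℕ} (p : Euc n → ℝ) (𝒜 : Euc n → ℝ → Euc n → Euc n)
    (u : Euc n → ℝ) : Prop :=
  ContDiff ℝ 1 u ∧
  LocallyIntegrable (fun x => ‖gradient u x‖ ^ p x) (volume : Measure (Euc n)) ∧
  ∀ φ : Euc n → ℝ, ContDiff ℝ ∞ φ → HasCompactSupport φ → (∀ x, 0 ≤ φ x) →
    ∫ x, (inner ℝ (𝒜 x (u x) (gradient u x)) (gradient φ x) : ℝ) ≤ 0

/-- `ℬ` is an admissible right-hand side. -/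
structure IsAdmissibleRHS {n : ℕ} (p : Euc n → ℝ) (ℬ : Euc n → ℝ → Euc n → ℝ) : Prop where
  meas : ∀ (t : ℝ) (ξ : Euc n), Measurable (fun x => ℬ x t ξ)
  cont : ∀ x : Euc n, Continuous (fun tξ : ℝ × Euc n => ℬ x tξ.1 tξ.2)
  bound : ∃ c : Euc n → ℝ, Measurable c ∧ (∃ cP : ℝ, ∀ x, c x ≤ cP) ∧
      ∀ x t ξ, |ℬ x t ξ| ≤ c x * (1 + ‖ξ‖ ^ (p x - 1))

/-- `u` is `(𝒜,ℬ)`-harmonic in `ℝⁿ`. -/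
def IsABHarmonic {n : ℕ} (p : Euc n → ℝ) (𝒜 : Euc n → ℝ → Euc n → Euc n)
    (ℬ : Euc n → ℝ → Euc n → ℝ) (u : Euc n → ℝ) : Prop :=
  ContDiff ℝ 1 u ∧
  LocallyIntegrable (fun x => ‖gradient u x‖ ^ p x) (volume : Measure (Euc n)) ∧
  ∀ φ : Euc n → ℝ, ContDiff ℝ ∞ φ → HasCompactSupport φ →
    ∫ x, (inner ℝ (𝒜 x (u x) (gradient u x)) (gradient φ x) : ℝ)
      = ∫ x, ℬ x (u x) (gradient u x) * φ x

/-- `u` is a supersolution of `div 𝒜(x,u,∇u) = f(u)` in `ℝⁿ`. -/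
def IsFSupersolution {n : ℕ} (p : Euc n → ℝ) (𝒜 : Euc n → ℝ → Euc n → Euc n)
    (f : ℝ → ℝ) (u : Euc n → ℝ) : Prop :=
  ContDiff ℝ 1 u ∧
  LocallyIntegrable (fun x => ‖gradient u x‖ ^ p x) (volume : Measure (Euc n)) ∧
  ∀ φ : Euc n → ℝ, ContDiff ℝ ∞ φ → HasCompactSupport φ → (∀ x, 0 ≤ φ x) →
    ∫ x, f (u x) * φ x ≤ - ∫ x, (inner ℝ (𝒜 x (u x) (gradient u x)) (gradient φ x) : ℝ)


section Approximation

/-- A nonnegative compactly supported `C¹` function can be approximated uniformly, together with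
its gradient, by nonnegative smooth functions supported in a fixed compact neighbourhood. -/
theorem exists_contDiff_gradient_approx {n : ℕ} {φ : Euc n → ℝ} (hφ : ContDiff ℝ 1 φ)
    (hc : HasCompactSupport φ) (h0 : ∀ x, 0 ≤ φ x) {ε : ℝ} (hε : 0 < ε) :
    ∃ ψ : Euc n → ℝ, ContDiff ℝ ∞ ψ ∧ HasCompactSupport ψ ∧ (∀ x, 0 ≤ ψ x) ∧
      tsupport ψ ⊆ cthickening 1 (tsupport φ) ∧ (∀ x, ‖ψ x - φ x‖ ≤ ε) ∧
      ∀ x, ‖gradient ψ x - gradient φ x‖ ≤ ε := by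
  have hdc : Continuous (fderiv ℝ φ) := hφ.continuous_fderiv one_ne_zero
  obtain ⟨δ₁, hδ₁, H₁⟩ := Metric.uniformContinuous_iff.1
    (hc.uniformContinuous_of_continuous hφ.continuous) ε hε
  obtain ⟨δ₂, hδ₂, H₂⟩ := Metric.uniformContinuous_iff.1
    ((hc.fderiv ℝ).uniformContinuous_of_continuous hdc) ε hε
  obtain ⟨r, hr, hr₁, hr₂, hr3⟩ : ∃ r : ℝ, 0 < r ∧ r ≤ δ₁ ∧ r ≤ δ₂ ∧ r ≤ 1 :=
    ⟨min δ₁ (min δ₂ 1), by positivity, min_le_left _ _,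
      (min_le_right _ _).trans (min_le_left _ _), (min_le_right _ _).trans (min_le_right _ _)⟩
  let ρ : ContDiffBump (0 : Euc n) := ⟨r / 2, r, by positivity, by linarith⟩
  have hρr : ρ.rOut = r := rfl
  set L := ContinuousLinearMap.lsmul ℝ ℝ (E := ℝ) with hL
  have hli : LocallyIntegrable (ρ.normed (volume : Measure (Euc n))) volume :=
    ρ.continuous_normed.locallyIntegrable
  have hsupp : Function.support (convolution (ρ.normed volume) φ L volume)
      ⊆ cthickening 1 (tsupport φ) := by
    refine (support_convolution_subset_swap L).trans ?_
    rintro _ ⟨y, hy, z, hz, rfl⟩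
    rw [ρ.support_normed_eq, hρr, mem_ball_zero_iff] at hz
    refine mem_cthickening_of_dist_le _ y 1 _ (subset_tsupport _ hy) ?_
    simp only [dist_eq_norm, add_sub_cancel_left]
    linarith
  have hsupp' := closure_minimal hsupp isClosed_cthickening
  refine ⟨convolution (ρ.normed volume) φ L volume, ?_, ?_, ?_, hsupp', ?_, ?_⟩
  · exact ρ.hasCompactSupport_normed.contDiff_convolution_left L ρ.contDiff_normed
      hφ.continuous.locallyIntegrable
  · exact ρ.hasCompactSupport_normed.convolution L hc
  · intro x
    exact integral_nonneg fun t => mul_nonneg (ρ.nonneg_normed t) (h0 _)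
  · intro x
    rw [← dist_eq_norm]
    refine ρ.dist_normed_convolution_le hφ.continuous.aestronglyMeasurable fun y hy => ?_
    exact (H₁ (lt_of_lt_of_le hy hr₁)).le
  · intro x
    have hd := hc.hasFDerivAt_convolution_right L hli hφ x
    have hpre : L.precompR (Euc n) = ContinuousLinearMap.lsmul ℝ ℝ (E := Euc n →L[ℝ] ℝ) := by
      ext c T
      rfl
    rw [gradient, gradient, ← map_sub, LinearIsometryEquiv.norm_map, hd.fderiv, hpre,
      ← dist_eq_norm]
    refine ρ.dist_normed_convolution_le hdc.aestronglyMeasurable fun y hy => ?_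
    exact (H₂ (lt_of_lt_of_le hy hr₂)).le

theorem integrable_inner_of_integrableOn {α E : Type*} [MeasurableSpace α] {μ : Measure α}
    [TopologicalSpace α] [OpensMeasurableSpace α] [SecondCountableTopology α]
    [T2Space α] [NormedAddCommGroup E] [InnerProductSpace ℝ E] {F G : α → E} {K : Set α}
    (hK : IsCompact K) (hF : IntegrableOn F K μ) (hG : Continuous G) (hG0 : ∀ x ∉ K, G x = 0) :
    Integrable (fun x => inner ℝ (F x) (G x)) μ := by
  obtain ⟨C, hC⟩ := hK.exists_bound_of_continuousOn hG.continuousOn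
  have hs : Function.support (fun x => inner ℝ (F x) (G x)) ⊆ K := by
    intro x hx
    by_contra h
    exact hx (by simp [hG0 x h])
  rw [← integrableOn_iff_integrable_of_support_subset hs]
  refine Integrable.mono' (hF.norm.mul_const C)
    (hF.aestronglyMeasurable.inner
      (hG.continuousOn.aestronglyMeasurable_of_isCompact hK hK.measurableSet)) ?_
  filter_upwards [ae_restrict_mem hK.measurableSet] with x hx
  exact (norm_inner_le_norm _ _).trans (by gcongr; exact hC x hx)

/-- Stability of `∫ ⟨F, G⟩` under uniform perturbations of `G` supported in a compact set. -/
theorem integral_inner_sub_le {α E : Type*} [MeasurableSpace α] {μ : Measure α}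
    [TopologicalSpace α] [OpensMeasurableSpace α] [SecondCountableTopology α]
    [T2Space α] [NormedAddCommGroup E] [InnerProductSpace ℝ E] {F G H : α → E} {K : Set α}
    (hK : IsCompact K) (hF : IntegrableOn F K μ) (hG : Continuous G) (hH : Continuous H)
    (hG0 : ∀ x ∉ K, G x = 0) (hH0 : ∀ x ∉ K, H x = 0) {ε : ℝ}
    (hGH : ∀ x, ‖G x - H x‖ ≤ ε) :
    ∫ x, inner ℝ (F x) (H x) ∂μ ≤ ∫ x, inner ℝ (F x) (G x) ∂μ + ε * ∫ x in K, ‖F x‖ ∂μ := by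
  have hiG := integrable_inner_of_integrableOn hK hF hG hG0
  have hiH := integrable_inner_of_integrableOn hK hF hH hH0
  have hiN : Integrable (K.indicator fun x => ε * ‖F x‖) μ :=
    (integrable_indicator_iff hK.measurableSet).2 (hF.norm.const_mul ε)
  rw [← integral_const_mul, ← integral_indicator hK.measurableSet, ← integral_add hiG hiN]
  refine integral_mono hiH (hiG.add hiN) fun x => ?_
  by_cases hx : x ∈ K
  · rw [Set.indicator_of_mem hx, ← sub_le_iff_le_add', ← inner_sub_right]
    refine (real_inner_le_norm _ _).trans ?_
    rw [mul_comm, norm_sub_rev]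
    gcongr
    exact hGH x
  · simp [hx, hG0 x hx, hH0 x hx]

end Approximation

section Supersolution

variable {n : ℕ} {p : Euc n → ℝ} {pm pP : ℝ} {𝒜 : Euc n → ℝ → Euc n → Euc n} {am bP : ℝ}

theorem continuous_gradient {u : Euc n → ℝ} (hu : ContDiff ℝ 1 u) : Continuous (gradient u) :=
  (InnerProductSpace.toDual ℝ (Euc n)).symm.continuous.comp (hu.continuous_fderiv one_ne_zero)

theorem gradient_eq_zero_of_notMem_tsupport {φ : Euc n → ℝ} {x : Euc n} (hx : x ∉ tsupport φ) :
    gradient φ x = 0 := by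
  have : fderiv ℝ φ x = 0 := by
    by_contra h
    exact hx (support_fderiv_subset ℝ h)
  simp [gradient, this]

theorem IsNSGrowth.integrableOn (hp : IsVarExp p pm pP) (h𝒜 : IsNSGrowth p 𝒜 am bP)
    {u : Euc n → ℝ} (hu : ContDiff ℝ 1 u) {K : Set (Euc n)} (hK : IsCompact K) :
    IntegrableOn (fun x => 𝒜 x (u x) (gradient u x)) K := by
  obtain ⟨a, b, -, -, hab, -, hb⟩ := h𝒜.growth
  have hm : Measurable (fun x => 𝒜 x (u x) (gradient u x)) :=
    (measurable_uncurry_of_continuous_of_measurable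
      (u := fun (i : ℝ × Euc n) x => 𝒜 x i.1 i.2) h𝒜.cont (fun i => h𝒜.meas i.1 i.2)).comp
      ((hu.continuous.prodMk (continuous_gradient hu)).measurable.prodMk measurable_id)
  obtain ⟨C, hC⟩ := hK.exists_bound_of_continuousOn (continuous_gradient hu).continuousOn
  refine Measure.integrableOn_of_bounded (M := bP * (1 + |C|) ^ (pP - 1)) hK.measure_lt_top.ne
    hm.aestronglyMeasurable ?_
  filter_upwards [ae_restrict_mem hK.measurableSet, ae_restrict_of_ae hp.ae_lb,
    ae_restrict_of_ae hp.ae_ub] with x hx h1 h2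
  have hp1 := hp.one_lt
  have hbP : 0 ≤ bP := by linarith [h𝒜.am_pos, hab x]
  have hCx : ‖gradient u x‖ ≤ 1 + |C| := by linarith [hC x hx, le_abs_self C]
  calc _ ≤ b x * ‖gradient u x‖ ^ (p x - 1) := hb _ _ _
    _ ≤ bP * (1 + |C|) ^ (p x - 1) := by
      gcongr
      · exact (hab x).2.2
      · linarith
    _ ≤ _ := by
      gcongr
      linarith [abs_nonneg C]

/-- The defining inequality of a supersolution extends to `C¹` test functions. -/
theorem IsFSupersolution.le_of_contDiff_one (hp : IsVarExp p pm pP) (h𝒜 : IsNSGrowth p 𝒜 am bP)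
    {f : ℝ → ℝ} (hf : Continuous f) {u : Euc n → ℝ} (hu : IsFSupersolution p 𝒜 f u)
    {φ : Euc n → ℝ} (hφ : ContDiff ℝ 1 φ) (hc : HasCompactSupport φ) (h0 : ∀ x, 0 ≤ φ x) :
    ∫ x, f (u x) * φ x
      ≤ - ∫ x, (inner ℝ (𝒜 x (u x) (gradient u x)) (gradient φ x) : ℝ) := by
  obtain ⟨hu1, -, hu⟩ := hu
  set K := cthickening 1 (tsupport φ)
  have hK : IsCompact K := hc.isCompact.cthickening
  have hφK : tsupport φ ⊆ K := self_subset_cthickening _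
  have hA := h𝒜.integrableOn hp hu1 hK
  have hfu : IntegrableOn (fun x => f (u x)) K :=
    (hf.comp hu1.continuous).continuousOn.integrableOn_compact hK
  set D := (∫ x in K, ‖f (u x)‖) + ∫ x in K, ‖𝒜 x (u x) (gradient u x)‖
  have hD : 0 ≤ D := add_nonneg (integral_nonneg fun _ => norm_nonneg _)
    (integral_nonneg fun _ => norm_nonneg _)
  refine le_of_forall_pos_le_add fun ε hε => ?_
  obtain ⟨ψ, hψ, hψc, hψ0, hψK, hψφ, hdψφ⟩ :=
    exists_contDiff_gradient_approx hφ hc h0 (ε := ε / (D + 1)) (by positivity)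
  have hψ1 : ContDiff ℝ 1 ψ := hψ.of_le (by exact_mod_cast le_top)
  have e1 := integral_inner_sub_le hK hfu hψ.continuous hφ.continuous
    (fun x hx => image_eq_zero_of_notMem_tsupport fun h => hx (hψK h))
    (fun x hx => image_eq_zero_of_notMem_tsupport fun h => hx (hφK h)) hψφ
  have e2 := integral_inner_sub_le hK hA (continuous_gradient hψ1) (continuous_gradient hφ)
    (fun x hx => gradient_eq_zero_of_notMem_tsupport fun h => hx (hψK h))
    (fun x hx => gradient_eq_zero_of_notMem_tsupport fun h => hx (hφK h)) hdψφ
  have e3 := hu ψ hψ hψc hψ0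
  simp only [Real.inner_apply] at e1
  have e4 : ε / (D + 1) * D ≤ ε := by
    rw [div_mul_eq_mul_div, div_le_iff₀ (by positivity)]
    nlinarith
  have e5 : ε / (D + 1) * D = ε / (D + 1) * (∫ x in K, ‖f (u x)‖)
    + ε / (D + 1) * ∫ x in K, ‖𝒜 x (u x) (gradient u x)‖ := mul_add _ _ _
  linarith

end Supersolution

section CutOff

theorem rpow_sub_one_mul_pow_le {t s q : ℝ} {N : ℕ} (ht : 0 ≤ t) (hs : 0 ≤ s) (hs1 : s ≤ 1)
    (hq : 1 < q) (hqN : q ≤ N + 1) : t ^ (q - 1) * s ^ N ≤ t ^ q * s ^ (N + 1) + 1 := by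
  have hq' : t ^ q = t ^ (q - 1) * t := by
    conv_lhs => rw [← sub_add_cancel q 1]
    rw [Real.rpow_add_one' ht (by linarith)]
  have hnn : 0 ≤ t ^ (q - 1) * s ^ N := by positivity
  rcases le_total 1 (t * s) with h | h
  · have : t ^ q * s ^ (N + 1) = t ^ (q - 1) * s ^ N * (t * s) := by rw [hq']; ring
    nlinarith
  · have h1 : s ^ N ≤ s ^ (q - 1) := by
      rw [← Real.rpow_natCast]
      rcases hs.eq_or_lt with rfl | hs'
      · rw [Real.zero_rpow (by linarith), Real.zero_rpow (by linarith)]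
      · exact Real.rpow_le_rpow_of_exponent_ge hs' hs1 (by linarith)
    have h2 : t ^ (q - 1) * s ^ N ≤ 1 :=
      calc _ ≤ t ^ (q - 1) * s ^ (q - 1) := by gcongr
        _ = (t * s) ^ (q - 1) := (Real.mul_rpow ht hs).symm
        _ ≤ 1 := Real.rpow_le_one (by positivity) h (by linarith)
    have : 0 ≤ t ^ q * s ^ (N + 1) := by positivity
    linarith

/-- Cut-off functions between `B_R` and `B_{2R}` with gradient of order `1/R`. -/
theorem exists_cutoff (n : ℕ) : ∃ K : ℝ, 0 ≤ K ∧ ∀ R : ℝ, 0 < R → ∃ η : Euc n → ℝ,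
    ContDiff ℝ ∞ η ∧ (∀ x, 0 ≤ η x ∧ η x ≤ 1) ∧ (∀ x ∈ ball (0 : Euc n) R, η x = 1) ∧
    tsupport η ⊆ closedBall 0 (2 * R) ∧ ∀ x, ‖gradient η x‖ ≤ K / R := by
  let η₀ : ContDiffBump (0 : Euc n) := ⟨1, 2, one_pos, one_lt_two⟩
  obtain ⟨K, hK⟩ := (η₀.contDiff (n := 1)).continuous_fderiv one_ne_zero
    |>.bounded_above_of_compact_support (η₀.hasCompactSupport.fderiv ℝ)
  refine ⟨K, (norm_nonneg _).trans (hK 0), fun R hR => ⟨fun x => η₀ (R⁻¹ • x), ?_, ?_, ?_, ?_, ?_⟩⟩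
  · exact η₀.contDiff.comp (contDiff_id.const_smul R⁻¹)
  · exact fun x => ⟨η₀.nonneg, η₀.le_one⟩
  · intro x hx
    refine η₀.one_of_mem_closedBall ?_
    rw [mem_ball_zero_iff] at hx
    rw [mem_closedBall_zero_iff, norm_smul, norm_inv, norm_of_nonneg hR.le]
    exact (inv_mul_le_one₀ hR).2 hx.le
  · refine closure_minimal (fun x hx => ?_) isClosed_closedBall
    have : R⁻¹ • x ∈ Function.support η₀ := hx
    rw [η₀.support_eq, mem_ball_zero_iff, norm_smul, norm_inv, norm_of_nonneg hR.le,
      inv_mul_lt_iff₀ hR] at this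
    rw [mem_closedBall_zero_iff, mul_comm]
    exact this.le
  · intro x
    rw [gradient, LinearIsometryEquiv.norm_map, fderiv_comp_smul (f := η₀), norm_smul, norm_inv,
      norm_of_nonneg hR.le, div_eq_inv_mul]
    gcongr
    exact hK _

theorem gradient_add_const_mul_pow {n : ℕ} {u η : Euc n → ℝ} (hu : ContDiff ℝ 1 u)
    (hη : ContDiff ℝ 1 η) (c : ℝ) (N : ℕ) (x : Euc n) :
    gradient (fun y => (u y + c) * η y ^ (N + 1)) x =
      η x ^ (N + 1) • gradient u x + ((u x + c) * ((N + 1) * η x ^ N)) • gradient η x := by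
  have h1 := (hu.differentiable one_ne_zero x).hasFDerivAt.add_const c
  have h2 := (hη.differentiable one_ne_zero x).hasFDerivAt.pow (N + 1)
  rw [gradient, (h1.fun_mul h2).fderiv]
  simp only [gradient, map_add, map_smul, smul_smul, Nat.add_sub_cancel]
  rw [add_comm]
  simp

end CutOff

/-- Corollary 4.12: let `p⁻ > n` and let `f` be continuous, nonnegative, strictly
increasing with `f(0) ≠ 0`. Then there exists no bounded supersolution of
`div 𝒜(x,u,∇u) = f(u)` in `ℝⁿ`. -/
theorem nonexistence_strictly_increasing {n : ℕ} (p : Euc n → ℝ) (pm pP : ℝ)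
    (hp : IsVarExp p pm pP) (hpn : (n : ℝ) < pm)
    (𝒜 : Euc n → ℝ → Euc n → Euc n) (am bP : ℝ)
    (h𝒜 : IsNSGrowth p 𝒜 am bP)
    (f : ℝ → ℝ) (hfc : Continuous f) (hf0 : ∀ t, 0 ≤ f t)
    (hmono : StrictMono f) (hf0ne : f 0 ≠ 0) :
    ¬ ∃ (u : Euc n → ℝ) (M : ℝ),
        IsFSupersolution p 𝒜 f u ∧ ∀ x, |u x| ≤ M := by

  rintro ⟨u, M, hu, hM⟩
  have hu1 : ContDiff ℝ 1 u := hu.1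
  obtain ⟨K, hK, hcut⟩ := exists_cutoff n
  obtain ⟨N, hN⟩ := exists_nat_ge pP
  obtain ⟨a, b, -, -, hab, ha, hb⟩ := h𝒜.growth
  have hM0 : 0 ≤ M := (abs_nonneg _).trans (hM 0)
  have ham := h𝒜.am_pos
  have hbP : 0 ≤ bP := by linarith [hab 0]
  have hc : 0 < f (-M) := (hf0 (-M - 1)).trans_lt (hmono (by linarith))
  set c := f (-M)
  set C := (2 * M + 1) * (N + 1) * bP * K with hC
  have hC0 : 0 ≤ C := by positivity
  set R := C / am + C * 2 ^ n / c + 1 with hR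
  have hR0 : 0 < R := by positivity
  have hCam : C / R ≤ am := by
    rw [div_le_iff₀ hR0, mul_comm, ← div_le_iff₀ ham]
    linarith [show 0 ≤ C * 2 ^ n / c by positivity]
  have hCc : C / R * 2 ^ n < c := by
    rw [div_mul_eq_mul_div, div_lt_iff₀ hR0, mul_comm c, ← div_lt_iff₀ hc]
    linarith [show 0 ≤ C / am by positivity]
  obtain ⟨η, hη, hη01, hη1, hηs, hdη⟩ := hcut R hR0
  have hη' : ContDiff ℝ 1 η := hη.of_le (by exact_mod_cast le_top)
  have hw : ∀ x, 1 ≤ u x + (M + 1) ∧ u x + (M + 1) ≤ 2 * M + 1 := fun x => by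
    have := abs_le.1 (hM x)
    constructor <;> linarith
  set φ : Euc n → ℝ := fun y => (u y + (M + 1)) * η y ^ (N + 1) with hφdef
  have hφ : ContDiff ℝ 1 φ := (hu1.add contDiff_const).mul (hη'.pow _)
  have hφ0 : ∀ x, 0 ≤ φ x := fun x =>
    mul_nonneg (by linarith [hw x]) (pow_nonneg (hη01 x).1 _)
  have hφs : tsupport φ ⊆ closedBall 0 (2 * R) := by
    refine closure_minimal (fun x hx => hηs (subset_tsupport _ fun h => hx ?_))
      isClosed_closedBall
    simp [hφdef, h]
  have hφc : HasCompactSupport φ :=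
    (isCompact_closedBall _ _).of_isClosed_subset (isClosed_tsupport _) hφs
  have hmain := hu.le_of_contDiff_one hp h𝒜 hfc hφ hφc hφ0
  have hball : (volume : Measure (Euc n)).real (ball 0 R) = R ^ n * omegaEuc n := by
    rw [measureReal_def, Measure.addHaar_ball_of_pos _ _ hR0, ENNReal.toReal_mul,
      ENNReal.toReal_ofReal (by positivity), finrank_euclideanSpace_fin]
    rfl
  have hcball : (volume : Measure (Euc n)).real (closedBall 0 (2 * R))
      = (2 * R) ^ n * omegaEuc n := by
    rw [Measure.addHaar_real_closedBall _ _ (by positivity), finrank_euclideanSpace_fin]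
    rfl
  have hω : 0 < omegaEuc n :=
    ENNReal.toReal_pos (measure_ball_pos _ _ one_pos).ne' measure_ball_lt_top.ne
  have hlow : c * (R ^ n * omegaEuc n) ≤ ∫ x, f (u x) * φ x := by
    rw [← hball, mul_comm, ← smul_eq_mul, ← integral_indicator_const _ measurableSet_ball]
    refine integral_mono ((integrable_indicator_iff measurableSet_ball).2
      (integrableOn_const measure_ball_lt_top.ne))
      (((hfc.comp hu1.continuous).mul hφ.continuous).integrable_of_hasCompactSupport
        hφc.mul_left) fun x => ?_
    by_cases hx : x ∈ ball 0 R
    · have h1 : c ≤ f (u x) := hmono.monotone (abs_le.1 (hM x)).1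
      have h2 : 1 ≤ φ x := by simpa [hφdef, hη1 x hx] using (hw x).1
      simp only [Set.indicator_of_mem hx]
      nlinarith
    · simpa only [Set.indicator_of_notMem hx] using mul_nonneg (hf0 _) (hφ0 x)
  have hflux : -(C / R) * ((2 * R) ^ n * omegaEuc n)
      ≤ ∫ x, (inner ℝ (𝒜 x (u x) (gradient u x)) (gradient φ x) : ℝ) := by
    rw [← hcball, mul_comm, ← smul_eq_mul, ← integral_indicator_const _ measurableSet_closedBall]
    refine integral_mono_ae ((integrable_indicator_iff measurableSet_closedBall).2
      (integrableOn_const measure_closedBall_lt_top.ne))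
      (integrable_inner_of_integrableOn (isCompact_closedBall 0 (2 * R))
        (h𝒜.integrableOn hp hu1 (isCompact_closedBall _ _)) (continuous_gradient hφ)
        fun x hx => gradient_eq_zero_of_notMem_tsupport fun h => hx (hφs h)) ?_
    filter_upwards [hp.ae_lb, hp.ae_ub] with x h1 h2
    by_cases hx : x ∈ closedBall 0 (2 * R)
    · simp only [Set.indicator_of_mem hx]
      rw [gradient_add_const_mul_pow hu1 hη' (M + 1) N x, inner_add_right, inner_smul_right,
        inner_smul_right]
      obtain ⟨hs0, hs1⟩ := hη01 x
      have hY := rpow_sub_one_mul_pow_le (norm_nonneg (gradient u x)) hs0 hs1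
        (hp.one_lt.trans_le h1) (N := N) (by linarith)
      set g := ‖gradient u x‖
      have hg : 0 ≤ g := norm_nonneg _
      have hell : am * g ^ p x ≤ inner ℝ (𝒜 x (u x) (gradient u x)) (gradient u x) :=
        le_trans (by gcongr; exact (hab x).1) (ha x (u x) (gradient u x))
      have hgrow : |inner ℝ (𝒜 x (u x) (gradient u x)) (gradient η x)|
          ≤ bP * g ^ (p x - 1) * (K / R) := by
        refine (abs_real_inner_le_norm _ _).trans ?_
        gcongr
        · exact (hb _ _ _).trans (by gcongr; exact (hab x).2.2)
        · exact hdη x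
      have hlower := (abs_le.1 hgrow).1
      have hw0 : 0 ≤ u x + (M + 1) := by linarith [hw x]
      have hcross : (u x + (M + 1)) * ((N + 1) * η x ^ N)
          * (bP * g ^ (p x - 1) * (K / R)) ≤ C / R * (g ^ p x * η x ^ (N + 1) + 1) :=
        calc _ ≤ (2 * M + 1) * ((N + 1) * η x ^ N) * (bP * g ^ (p x - 1) * (K / R)) := by
              gcongr ?_ * _ * _
              exact (hw x).2
          _ = C / R * (g ^ (p x - 1) * η x ^ N) := by rw [hC]; ring
          _ ≤ _ := by gcongr
      have h3 := mul_le_mul_of_nonneg_left hell (pow_nonneg hs0 (N + 1))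
      have h4 := mul_le_mul_of_nonneg_left hlower
        (show 0 ≤ (u x + (M + 1)) * ((N + 1) * η x ^ N) by positivity)
      have h5 := mul_le_mul_of_nonneg_right hCam
        (show 0 ≤ g ^ p x * η x ^ (N + 1) by positivity)
      linarith
    · simp only [Set.indicator_of_notMem hx]
      rw [gradient_eq_zero_of_notMem_tsupport fun h => hx (hφs h), inner_zero_right]
  have hfin : c * (R ^ n * omegaEuc n) ≤ C / R * 2 ^ n * (R ^ n * omegaEuc n) := by
    rw [mul_pow] at hflux
    linarith
  exact hCc.not_ge (le_of_mul_le_mul_right hfin (by positivity))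

end
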